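/- arXiv:2103.16170 — 5 statements merged into one kernel-verified Lean document; each statement's English description precedes it below -/
import Mathlib

section
/- Let K ∈ ℝ^{n×n} be symmetric positive semidefinite, σ > 0, and let E ∈ ℝ^{M×n} be a matrix each of whose rows is a standard basis vector of ℝ^n and each of whose columns is nonzero, so that E^⊤E = diag(m) for a vector m of positive integers. Set Z := (K + σ² diag(m)^{-1})^{-1} and, for y ∈ ℝ^M, set ζ := diag(m)^{-1} E^⊤ y. Then for every μ₀ ∈ ℝ^n: (i) E^⊤ (E K E^⊤ + σ² I_M)^{-1} (y − E μ₀) = Z (ζ − μ₀), and (ii) E^⊤ (E K E^⊤ + σ² I_M)^{-1} E = Z. Consequently, the Gaussian-process posterior mean μ(x) = μ₀(x) + k₀(x,P) Z (ζ − μ₀(P)) and covariance k(x,x′) = k₀(x,x′) − k₀(x,P) Z k₀(P,x′) computed from the compressed data (P, ζ) coincide with the posterior computed from the full repeated data (X, y). -/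
open Matrix

/-- Push-through identity: if `Eᵀ * E` has inverse `W`, then `Eᵀ (E K Eᵀ + c I)⁻¹` equals
`(K + c W)⁻¹ W Eᵀ`. -/
theorem Matrix.transpose_mul_inv_add_smul_one {p q R : Type*} [Fintype p] [Fintype q]
    [DecidableEq p] [DecidableEq q] [CommRing R] {K W : Matrix q q R} {E : Matrix p q R} {c : R}
    (hW : W * (Eᵀ * E) = 1) (hA : IsUnit (E * K * Eᵀ + c • (1 : Matrix p p R)).det)
    (hB : IsUnit (K + c • W).det) :
    Eᵀ * (E * K * Eᵀ + c • (1 : Matrix p p R))⁻¹ = (K + c • W)⁻¹ * (W * Eᵀ) := by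
  have h : W * Eᵀ * (E * K * Eᵀ + c • (1 : Matrix p p R)) = (K + c • W) * Eᵀ := by
    rw [Matrix.mul_add, Matrix.add_mul, Matrix.mul_smul, Matrix.mul_one, Matrix.smul_mul]
    congr 1
    calc W * Eᵀ * (E * K * Eᵀ) = W * (Eᵀ * E) * (K * Eᵀ) := by simp only [Matrix.mul_assoc]
      _ = K * Eᵀ := by rw [hW, Matrix.one_mul]
  calc Eᵀ * (E * K * Eᵀ + c • (1 : Matrix p p R))⁻¹
      = (K + c • W)⁻¹ * ((K + c • W) * Eᵀ) * (E * K * Eᵀ + c • (1 : Matrix p p R))⁻¹ := by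
        rw [Matrix.nonsing_inv_mul_cancel_left _ _ hB]
    _ = (K + c • W)⁻¹ * (W * Eᵀ) := by
        rw [← h, Matrix.mul_assoc, Matrix.mul_nonsing_inv_cancel_right _ _ hA]

/-- **Proposition 1 (GP data compression).**
Let `K ∈ ℝ^{n×n}` be symmetric positive semidefinite, `σ > 0`, and let `E ∈ ℝ^{M×n}` have rows
which are standard basis vectors of `ℝ^n` and nonzero columns, so that `Eᵀ E = diag m` for a
vector `m` of positive integers.  With `Z := (K + σ² diag(m)⁻¹)⁻¹` and `ζ := diag(m)⁻¹ Eᵀ y`,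
we have (i) `Eᵀ (E K Eᵀ + σ² I)⁻¹ (y − E μ₀) = Z (ζ − μ₀)` and
(ii) `Eᵀ (E K Eᵀ + σ² I)⁻¹ E = Z`.  Consequently the GP posterior mean and covariance computed
from the compressed data coincide with those computed from the full repeated data. -/
theorem gp_data_compression {n M : ℕ}
    (K : Matrix (Fin n) (Fin n) ℝ) (hK : K.PosSemidef)
    (σ : ℝ) (hσ : 0 < σ)
    (E : Matrix (Fin M) (Fin n) ℝ)
    (hrow : ∀ i : Fin M, ∃ j : Fin n, E i = Pi.single j 1)
    (hcol : ∀ j : Fin n, ∃ i : Fin M, E i j ≠ 0)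
    (m : Fin n → ℕ) (hm : ∀ i, 0 < m i)
    (hEE : Eᵀ * E = Matrix.diagonal (fun i => (m i : ℝ)))
    (y : Fin M → ℝ) (μ₀ : Fin n → ℝ) :
    Eᵀ.mulVec ((E * K * Eᵀ + σ ^ 2 • (1 : Matrix (Fin M) (Fin M) ℝ))⁻¹.mulVec
        (y - E.mulVec μ₀)) =
      (K + σ ^ 2 • Matrix.diagonal (fun i => ((m i : ℝ))⁻¹))⁻¹.mulVec
        (((Matrix.diagonal (fun i => (m i : ℝ)))⁻¹.mulVec (Eᵀ.mulVec y)) - μ₀) ∧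
    Eᵀ * (E * K * Eᵀ + σ ^ 2 • (1 : Matrix (Fin M) (Fin M) ℝ))⁻¹ * E =
      (K + σ ^ 2 • Matrix.diagonal (fun i => ((m i : ℝ))⁻¹))⁻¹ ∧
    (∀ μ₀x : ℝ, ∀ kxP kx'P : Fin n → ℝ,
      μ₀x + (E.mulVec kxP) ⬝ᵥ ((E * K * Eᵀ + σ ^ 2 • (1 : Matrix (Fin M) (Fin M) ℝ))⁻¹.mulVec
          (y - E.mulVec μ₀)) =
        μ₀x + kxP ⬝ᵥ ((K + σ ^ 2 • Matrix.diagonal (fun i => ((m i : ℝ))⁻¹))⁻¹.mulVec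
          (((Matrix.diagonal (fun i => (m i : ℝ)))⁻¹.mulVec (Eᵀ.mulVec y)) - μ₀)) ∧
      ∀ kxx' : ℝ,
      kxx' - (E.mulVec kxP) ⬝ᵥ ((E * K * Eᵀ + σ ^ 2 • (1 : Matrix (Fin M) (Fin M) ℝ))⁻¹.mulVec
          (E.mulVec kx'P)) =
        kxx' - kxP ⬝ᵥ ((K + σ ^ 2 • Matrix.diagonal (fun i => ((m i : ℝ))⁻¹))⁻¹.mulVec kx'P)) := by
  have hm' : ∀ i, (0 : ℝ) < m i := fun i => Nat.cast_pos.mpr (hm i)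
  have hσ2 : 0 < σ ^ 2 := pow_pos hσ 2
  set W : Matrix (Fin n) (Fin n) ℝ := Matrix.diagonal (fun i => ((m i : ℝ))⁻¹) with hWdef
  have hW : W * (Eᵀ * E) = 1 := by
    rw [hEE, hWdef, Matrix.diagonal_mul_diagonal, ← Matrix.diagonal_one]
    congr 1
    funext i
    exact inv_mul_cancel₀ (hm' i).ne'
  have hD : (Matrix.diagonal (fun i => (m i : ℝ)))⁻¹ = W :=
    Matrix.inv_eq_left_inv (hEE ▸ hW)
  have hWpos : W.PosDef := Matrix.PosDef.diagonal fun i => inv_pos.mpr (hm' i)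
  have hB : IsUnit (K + σ ^ 2 • W).det :=
    (Matrix.PosDef.posSemidef_add hK (hWpos.smul hσ2)).det_pos.ne'.isUnit
  have hEKE : (E * K * Eᵀ).PosSemidef := by
    simpa using hK.mul_mul_conjTranspose_same E
  have hA : IsUnit (E * K * Eᵀ + σ ^ 2 • (1 : Matrix (Fin M) (Fin M) ℝ)).det :=
    (Matrix.PosDef.posSemidef_add hEKE (Matrix.PosDef.one.smul hσ2)).det_pos.ne'.isUnit
  have key := Matrix.transpose_mul_inv_add_smul_one hW hA hB
  rw [hD]
  set A := E * K * Eᵀ + σ ^ 2 • (1 : Matrix (Fin M) (Fin M) ℝ)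
  have hcov : Eᵀ * A⁻¹ * E = (K + σ ^ 2 • W)⁻¹ := by
    rw [key, Matrix.mul_assoc, Matrix.mul_assoc, hW, Matrix.mul_one]
  have hmean : Eᵀ *ᵥ (A⁻¹ *ᵥ (y - E *ᵥ μ₀)) =
      (K + σ ^ 2 • W)⁻¹ *ᵥ (W *ᵥ (Eᵀ *ᵥ y) - μ₀) := by
    rw [Matrix.mulVec_mulVec, Matrix.mulVec_sub, Matrix.mulVec_mulVec, hcov, key,
      Matrix.mulVec_sub, Matrix.mulVec_mulVec, Matrix.mulVec_mulVec, Matrix.mul_assoc]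
  have hdot : ∀ (a : Fin n → ℝ) (v : Fin M → ℝ), E *ᵥ a ⬝ᵥ v = a ⬝ᵥ Eᵀ *ᵥ v := fun a v => by
    rw [Matrix.mulVec_transpose, dotProduct_comm, Matrix.dotProduct_mulVec, dotProduct_comm]
  refine ⟨hmean, hcov, fun μ₀x kxP kx'P => ⟨?_, fun kxx' => ?_⟩⟩
  · rw [hdot, hmean]
  · rw [hdot, Matrix.mulVec_mulVec, Matrix.mulVec_mulVec, hcov]
end

section
/- Let K ∈ ℝ^{n×n} be symmetric positive semidefinite, σ > 0, and let E ∈ ℝ^{M×n} be a matrix each of whose rows is a standard basis vector of ℝ^n and each of whose columns is nonzero, so that E^⊤E = diag(m) with all m_i > 0. Then E K E^⊤ + σ² I_M and K + σ² (E^⊤E)^{-1} are invertible, and E^⊤ (E K E^⊤ + σ² I_M)^{-1} = (K + σ² (E^⊤E)^{-1})^{-1} (E^⊤E)^{-1} E^⊤. -/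
open Matrix

/-- Key matrix identity in the proof of Proposition 1 (GP data compression):
`E K Eᵀ + σ² I_M` and `K + σ² (EᵀE)⁻¹` are invertible, and
`Eᵀ (E K Eᵀ + σ² I_M)⁻¹ = (K + σ² (EᵀE)⁻¹)⁻¹ (EᵀE)⁻¹ Eᵀ`. -/
theorem gp_compression_matrix_identity {n M : ℕ}
    (K : Matrix (Fin n) (Fin n) ℝ) (hK : K.PosSemidef)
    (σ : ℝ) (hσ : 0 < σ)
    (E : Matrix (Fin M) (Fin n) ℝ)
    (hrow : ∀ i : Fin M, ∃ j : Fin n, E i = Pi.single j 1)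
    (hcol : ∀ j : Fin n, ∃ i : Fin M, E i j ≠ 0)
    (m : Fin n → ℕ) (hm : ∀ i, 0 < m i)
    (hEE : Eᵀ * E = Matrix.diagonal (fun i => (m i : ℝ))) :
    IsUnit (E * K * Eᵀ + σ ^ 2 • (1 : Matrix (Fin M) (Fin M) ℝ)) ∧
    IsUnit (K + σ ^ 2 • (Eᵀ * E)⁻¹) ∧
    Eᵀ * (E * K * Eᵀ + σ ^ 2 • (1 : Matrix (Fin M) (Fin M) ℝ))⁻¹ =
      (K + σ ^ 2 • (Eᵀ * E)⁻¹)⁻¹ * (Eᵀ * E)⁻¹ * Eᵀ := by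
  have hσ2 : 0 < σ ^ 2 := by positivity
  have hD : (Eᵀ * E).PosDef := by
    rw [hEE]
    exact PosDef.diagonal fun i => Nat.cast_pos.2 (hm i)
  have hA : (E * K * Eᵀ + σ ^ 2 • (1 : Matrix (Fin M) (Fin M) ℝ)).PosDef := by
    rw [← conjTranspose_eq_transpose_of_trivial]
    exact PosDef.posSemidef_add (hK.mul_mul_conjTranspose_same E) (PosDef.one.smul hσ2)
  have hB : (K + σ ^ 2 • (Eᵀ * E)⁻¹).PosDef := PosDef.posSemidef_add hK (hD.inv.smul hσ2)
  refine ⟨hA.isUnit, hB.isUnit, ?_⟩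
  have hcancel : (Eᵀ * E)⁻¹ * (Eᵀ * E) = 1 :=
    nonsing_inv_mul _ ((isUnit_iff_isUnit_det _).1 hD.isUnit)
  have hintertwine : (Eᵀ * E)⁻¹ * Eᵀ * (E * K * Eᵀ + σ ^ 2 • (1 : Matrix (Fin M) (Fin M) ℝ)) =
      (K + σ ^ 2 • (Eᵀ * E)⁻¹) * Eᵀ := by
    have hassoc : (Eᵀ * E)⁻¹ * Eᵀ * (E * K * Eᵀ) = (Eᵀ * E)⁻¹ * (Eᵀ * E) * K * Eᵀ := by
      simp only [Matrix.mul_assoc]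
    rw [Matrix.mul_add, Matrix.add_mul, hassoc, hcancel, Matrix.one_mul, Matrix.mul_smul,
      Matrix.mul_one, Matrix.smul_mul]
  have hAdet := (isUnit_iff_isUnit_det _).1 hA.isUnit
  have hBdet := (isUnit_iff_isUnit_det _).1 hB.isUnit
  rw [Matrix.mul_assoc _ (Eᵀ * E)⁻¹ Eᵀ, ← mul_nonsing_inv_cancel_right _ ((Eᵀ * E)⁻¹ * Eᵀ) hAdet,
    hintertwine, Matrix.mul_assoc _ Eᵀ, nonsing_inv_mul_cancel_left _ _ hBdet]
end

section
/- Let p, M be positive integers and suppose the block matrix [[K_PP, K_PX],[K_XP, K_XX]] ∈ ℝ^{(p+M)×(p+M)} is symmetric positive semidefinite with K_PP ∈ ℝ^{p×p} positive definite and K_XP = K_PX^⊤. Let σ > 0, let Λ := K_XX − K_XP K_PP^{-1} K_PX, and for r ∈ ℝ^M let Γ := K_PX (Λ + σ² I_M)^{-1} K_XP and γ := K_PX (Λ + σ² I_M)^{-1} r. Then K_PX (K_XX + σ² I_M)^{-1} r = K_PP (K_PP + Γ)^{-1} γ. -/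
open Matrix

/-- Push-through identity for Schur complements: both sides arise from
`(A + U S⁻¹ V) A⁻¹ U = U S⁻¹ (S + V A⁻¹ U)`. -/
theorem Matrix.mul_inv_add_mul_inv_mul {m n R : Type*} [Fintype m] [DecidableEq m]
    [Fintype n] [DecidableEq n] [CommRing R]
    {A : Matrix m m R} (U : Matrix m n R) (V : Matrix n m R) {S : Matrix n n R}
    (hA : IsUnit A) (hS : IsUnit S) (hAS : IsUnit (A + U * S⁻¹ * V))
    (hSA : IsUnit (S + V * A⁻¹ * U)) :
    U * (S + V * A⁻¹ * U)⁻¹ = A * (A + U * S⁻¹ * V)⁻¹ * U * S⁻¹ := by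
  rw [isUnit_iff_isUnit_det] at hA hS hAS hSA
  have key : (A + U * S⁻¹ * V) * (A⁻¹ * U) = U * S⁻¹ * (S + V * A⁻¹ * U) := by
    simp only [Matrix.add_mul, Matrix.mul_add, mul_nonsing_inv_cancel_left _ _ hA,
      nonsing_inv_mul_cancel_right _ _ hS, Matrix.mul_assoc]
  have push : A⁻¹ * U = (A + U * S⁻¹ * V)⁻¹ * (U * S⁻¹ * (S + V * A⁻¹ * U)) := by
    rw [← key, nonsing_inv_mul_cancel_left _ _ hAS]
  calc U * (S + V * A⁻¹ * U)⁻¹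
      = A * (A⁻¹ * U) * (S + V * A⁻¹ * U)⁻¹ := by rw [mul_nonsing_inv_cancel_left _ _ hA]
    _ = A * (A + U * S⁻¹ * V)⁻¹ * U * S⁻¹ * (S + V * A⁻¹ * U) * (S + V * A⁻¹ * U)⁻¹ := by
      rw [push]; simp only [Matrix.mul_assoc]
    _ = _ := mul_nonsing_inv_cancel_right _ _ hSA

/-- Second expression for the pseudo-point posterior mean in sparse GP regression
(Snelson–Ghahramani): `K_PX (K_XX + σ²I)⁻¹ r = K_PP (K_PP + Γ)⁻¹ γ` where
`Λ = K_XX − K_XP K_PP⁻¹ K_PX`, `Γ = K_PX (Λ + σ²I)⁻¹ K_XP`, `γ = K_PX (Λ + σ²I)⁻¹ r`. -/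
theorem sparse_gp_mean_identity {p M : ℕ} (hp : 0 < p) (hM : 0 < M)
    (KPP : Matrix (Fin p) (Fin p) ℝ)
    (KPX : Matrix (Fin p) (Fin M) ℝ)
    (KXP : Matrix (Fin M) (Fin p) ℝ)
    (KXX : Matrix (Fin M) (Fin M) ℝ)
    (hblock : (Matrix.fromBlocks KPP KPX KXP KXX).PosSemidef)
    (hPP : KPP.PosDef)
    (hsym : KXP = KPXᵀ)
    (σ : ℝ) (hσ : 0 < σ) (r : Fin M → ℝ) :
    KPX.mulVec ((KXX + σ ^ 2 • (1 : Matrix (Fin M) (Fin M) ℝ))⁻¹.mulVec r) =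
      KPP.mulVec
        ((KPP + KPX * (KXX - KXP * KPP⁻¹ * KPX + σ ^ 2 • (1 : Matrix (Fin M) (Fin M) ℝ))⁻¹ *
            KXP)⁻¹.mulVec
          (KPX.mulVec
            ((KXX - KXP * KPP⁻¹ * KPX + σ ^ 2 • (1 : Matrix (Fin M) (Fin M) ℝ))⁻¹.mulVec r))) := by
  subst hsym
  have hI : (σ ^ 2 • (1 : Matrix (Fin M) (Fin M) ℝ)).PosDef := PosDef.one.smul (pow_pos hσ 2)
  have : Invertible KPP := hPP.isUnit.invertible
  have hΛ : (KXX - KPXᵀ * KPP⁻¹ * KPX).PosSemidef := by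
    simpa using (PosDef.fromBlocks₁₁ KPX KXX hPP).1 (by simpa using hblock)
  have hXX : KXX.PosSemidef := hblock.submatrix Sum.inr
  have hS := PosDef.posSemidef_add hΛ hI
  have hΓ : (KPX * (KXX - KPXᵀ * KPP⁻¹ * KPX + σ ^ 2 • 1)⁻¹ * KPXᵀ).PosSemidef := by
    simpa using hS.inv.posSemidef.mul_mul_conjTranspose_same KPX
  have hD : KXX - KPXᵀ * KPP⁻¹ * KPX + σ ^ 2 • 1 + KPXᵀ * KPP⁻¹ * KPX = KXX + σ ^ 2 • 1 := by
    abel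
  have h := mul_inv_add_mul_inv_mul KPX KPXᵀ hPP.isUnit hS.isUnit
    (hPP.add_posSemidef hΓ).isUnit (hD ▸ (PosDef.posSemidef_add hXX hI).isUnit)
  rw [hD] at h
  simp only [mulVec_mulVec, h, Matrix.mul_assoc]
end

section
/- Let p, M be positive integers and suppose the block matrix [[K_PP, K_PX],[K_XP, K_XX]] ∈ ℝ^{(p+M)×(p+M)} is symmetric positive semidefinite with K_PP ∈ ℝ^{p×p} positive definite and K_XP = K_PX^⊤. Let σ > 0, let Λ := K_XX − K_XP K_PP^{-1} K_PX, and let Γ := K_PX (Λ + σ² I_M)^{-1} K_XP. Then K_PP − K_PX (K_XX + σ² I_M)^{-1} K_XP = K_PP (K_PP + Γ)^{-1} K_PP. -/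
open Matrix

/-- Second expression for the pseudo-point posterior covariance in sparse GP regression
(Snelson–Ghahramani): `K_PP − K_PX (K_XX + σ²I)⁻¹ K_XP = K_PP (K_PP + Γ)⁻¹ K_PP` where
`Λ = K_XX − K_XP K_PP⁻¹ K_PX` and `Γ = K_PX (Λ + σ²I)⁻¹ K_XP`. -/
theorem sparse_gp_covariance_identity {p M : ℕ} (hp : 0 < p) (hM : 0 < M)
    (KPP : Matrix (Fin p) (Fin p) ℝ)
    (KPX : Matrix (Fin p) (Fin M) ℝ)
    (KXP : Matrix (Fin M) (Fin p) ℝ)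
    (KXX : Matrix (Fin M) (Fin M) ℝ)
    (hblock : (Matrix.fromBlocks KPP KPX KXP KXX).PosSemidef)
    (hPP : KPP.PosDef)
    (hsym : KXP = KPXᵀ)
    (σ : ℝ) (hσ : 0 < σ) :
    KPP - KPX * (KXX + σ ^ 2 • (1 : Matrix (Fin M) (Fin M) ℝ))⁻¹ * KXP =
      KPP *
        (KPP + KPX * (KXX - KXP * KPP⁻¹ * KPX + σ ^ 2 • (1 : Matrix (Fin M) (Fin M) ℝ))⁻¹ *
          KXP)⁻¹ * KPP := by
  have hσI : (σ ^ 2 • (1 : Matrix (Fin M) (Fin M) ℝ)).PosDef :=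
    PosDef.one.smul (pow_pos hσ 2)
  have hKXX : KXX.PosSemidef := hblock.submatrix Sum.inr
  have hXP : KXP = KPXᴴ := by rw [hsym, conjTranspose_eq_transpose_of_trivial]
  have hΛ : (KXX - KXP * KPP⁻¹ * KPX).PosSemidef := by
    have := hPP.isUnit.invertible
    rw [hXP] at hblock ⊢
    exact (PosDef.fromBlocks₁₁ KPX KXX hPP).mp hblock
  have hC : IsUnit (KXX - KXP * KPP⁻¹ * KPX + σ ^ 2 • (1 : Matrix (Fin M) (Fin M) ℝ)) :=
    (PosDef.posSemidef_add hΛ hσI).isUnit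
  have hS : (KXX - KXP * KPP⁻¹ * KPX + σ ^ 2 • (1 : Matrix (Fin M) (Fin M) ℝ))⁻¹⁻¹ +
      KXP * KPP⁻¹ * KPX = KXX + σ ^ 2 • (1 : Matrix (Fin M) (Fin M) ℝ) := by
    rw [nonsing_inv_nonsing_inv _ ((isUnit_iff_isUnit_det _).mp hC)]
    abel
  have hPP_det : IsUnit KPP.det := (isUnit_iff_isUnit_det _).mp hPP.isUnit
  rw [add_mul_mul_inv_eq_sub _ _ _ _ hPP.isUnit (isUnit_nonsing_inv_iff.mpr hC)
    (hS ▸ (PosDef.posSemidef_add hKXX hσI).isUnit), hS]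
  simp only [mul_sub, sub_mul, Matrix.mul_assoc, nonsing_inv_mul _ hPP_det,
    mul_nonsing_inv_cancel_left _ _ hPP_det, Matrix.mul_one]
end

section
/- Let K ∈ ℝ^{q×q} be symmetric positive definite, let E ∈ ℝ^{p×q} be a selection matrix whose rows are distinct standard basis vectors of ℝ^q (so E E^⊤ = I_p), let m ∈ ℝ^p have strictly positive entries, let σ > 0, and set Z := (E K E^⊤ + σ² diag(m)^{-1})^{-1}. Then for all μ₀ ∈ ℝ^q and ζ ∈ ℝ^p: (K^{-1} + σ^{-2} E^⊤ diag(m) E) (μ₀ + K E^⊤ Z (ζ − E μ₀)) = K^{-1} μ₀ + σ^{-2} E^⊤ diag(m) ζ. -/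
open Matrix

/-- Push-through identity: if `D D' = 1`, multiplying the gain `K F (E K F + s D')⁻¹` by the
information matrix `K⁻¹ + s⁻¹ F D E` gives `s⁻¹ F D`. -/
theorem Matrix.information_mul_gain {n k R : Type*} [Fintype n] [DecidableEq n] [Fintype k]
    [DecidableEq k] [Field R] {K : Matrix n n R} (hK : IsUnit K.det)
    (E : Matrix k n R) (F : Matrix n k R) {D D' : Matrix k k R} (hD : D * D' = 1)
    {s : R} (hs : s ≠ 0) (hS : IsUnit (E * K * F + s • D').det) :
    (K⁻¹ + s⁻¹ • (F * D * E)) * (K * F * (E * K * F + s • D')⁻¹) = s⁻¹ • (F * D) := by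
  have push : (K⁻¹ + s⁻¹ • (F * D * E)) * (K * F) =
      s⁻¹ • (F * D) * (E * K * F + s • D') := by
    rw [Matrix.add_mul, Matrix.mul_add, Matrix.nonsing_inv_mul_cancel_left _ _ hK, Matrix.smul_mul,
      Matrix.smul_mul, Matrix.smul_mul, Matrix.mul_smul, smul_smul, inv_mul_cancel₀ hs, one_smul,
      Matrix.mul_assoc F D D', hD, Matrix.mul_one, add_comm]
    simp only [Matrix.mul_assoc]
  rw [← Matrix.mul_assoc, push, Matrix.mul_nonsing_inv_cancel_right _ _ hS]

/-- Information-mean identity (pseudo-point information parameters):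
with `K` symmetric positive definite, selection matrix `E` (distinct standard basis rows,
`E Eᵀ = I`), positive weights `m`, `σ > 0`, and `Z := (E K Eᵀ + σ² diag(m)⁻¹)⁻¹`, for all
`μ₀ ∈ ℝ^q` and `ζ ∈ ℝ^p`:
`(K⁻¹ + σ⁻² Eᵀ diag(m) E)(μ₀ + K Eᵀ Z (ζ − E μ₀)) = K⁻¹ μ₀ + σ⁻² Eᵀ diag(m) ζ`. -/
theorem information_mean_identity {q p : ℕ}
    (K : Matrix (Fin q) (Fin q) ℝ) (hK : K.PosDef)
    (E : Matrix (Fin p) (Fin q) ℝ)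
    (hrow : ∀ i : Fin p, ∃ j : Fin q, E i = Pi.single j 1)
    (hdistinct : ∀ i i' : Fin p, i ≠ i' → E i ≠ E i')
    (hEEt : E * Eᵀ = 1)
    (m : Fin p → ℝ) (hm : ∀ i, 0 < m i)
    (σ : ℝ) (hσ : 0 < σ) :
    ∀ (μ₀ : Fin q → ℝ) (ζ : Fin p → ℝ),
      (K⁻¹ + (σ ^ 2)⁻¹ • (Eᵀ * Matrix.diagonal m * E)).mulVec
          (μ₀ + (K * Eᵀ * (E * K * Eᵀ + σ ^ 2 • Matrix.diagonal (fun i => (m i)⁻¹))⁻¹).mulVec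
            (ζ - E.mulVec μ₀)) =
        K⁻¹.mulVec μ₀ + (σ ^ 2)⁻¹ • (Eᵀ * Matrix.diagonal m).mulVec ζ := by
  intro μ₀ ζ
  have hS : (E * K * Eᵀ + σ ^ 2 • Matrix.diagonal (fun i => (m i)⁻¹)).PosDef := by
    have hEK : (E * K * Eᵀ).PosSemidef := by
      simpa using hK.posSemidef.mul_mul_conjTranspose_same E
    exact Matrix.PosDef.posSemidef_add hEK
      ((Matrix.PosDef.diagonal fun i => inv_pos.mpr (hm i)).smul (pow_pos hσ 2))
  have hD : Matrix.diagonal m * Matrix.diagonal (fun i => (m i)⁻¹) = 1 := by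
    simp [Matrix.diagonal_mul_diagonal, (hm _).ne']
  rw [Matrix.mulVec_add, Matrix.mulVec_mulVec,
    Matrix.information_mul_gain hK.det_pos.ne'.isUnit E Eᵀ hD (pow_pos hσ 2).ne'
      hS.det_pos.ne'.isUnit,
    Matrix.add_mulVec, Matrix.mulVec_sub, Matrix.mulVec_mulVec, Matrix.smul_mul,
    Matrix.smul_mulVec _ _ ζ]
  abel
end
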